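/- Let Δ ≥ 9 be an integer and let G be a minimal counterexample to the bound χ'_s ≤ 3Δ − 3 for graphs with Mad < 8/3 and maximum degree at most Δ. Then every vertex of G* has degree at least 2 in G*. -/

import Mathlib

open scoped Classical

namespace StrongEC

/-- Two edges of `G` conflict for strong edge-coloring: they are distinct and either share
an endpoint or are both adjacent to a common edge of `G`. -/
def Conflict {V : Type*} (G : SimpleGraph V) (e e' : Sym2 V) : Prop :=
  e ≠ e' ∧ ((∃ v, v ∈ e ∧ v ∈ e') ∨
    ∃ f ∈ G.edgeSet, (∃ v, v ∈ e ∧ v ∈ f) ∧ (∃ w, w ∈ e' ∧ w ∈ f))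

/-- `C` is a strong edge-coloring of `G` with `k` colors. -/
def IsStrongColoring {V : Type*} (G : SimpleGraph V) {k : ℕ} (C : Sym2 V → Fin k) : Prop :=
  ∀ e ∈ G.edgeSet, ∀ e' ∈ G.edgeSet, Conflict G e e' → C e ≠ C e'

/-- `G` admits a strong `k`-edge-coloring. -/
def HasStrongColoring {V : Type*} (G : SimpleGraph V) (k : ℕ) : Prop :=
  ∃ C : Sym2 V → Fin k, IsStrongColoring G C

/-- The strong chromatic index of `G`: the least `k` such that `G` admits a strong
`k`-edge-coloring. -/
noncomputable def strongChromaticIndex {V : Type*} (G : SimpleGraph V) : ℕ :=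
  sInf {k | HasStrongColoring G k}

/-- The maximum average degree of a finite graph `G`: the supremum over nonempty vertex
subsets `A` of `2 * e(A) / |A|`, where `e(A)` is the number of edges of `G` inside `A`
(this equals the maximum of `2|E(H)|/|V(H)|` over all subgraphs `H` with at least one
vertex). -/
noncomputable def mad {V : Type*} (G : SimpleGraph V) : ℝ :=
  sSup {x : ℝ | ∃ A : Finset V, A.Nonempty ∧
    x = 2 * ({e ∈ G.edgeSet | ∀ v ∈ e, v ∈ A}.ncard : ℝ) / (A.card : ℝ)}

/-- The graph `G*` obtained from `G` by deleting all vertices of degree 1 in `G`. -/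
noncomputable def core {V : Type*} [Fintype V] (G : SimpleGraph V) : SimpleGraph V :=
  SimpleGraph.fromRel (fun u v => G.Adj u v ∧ G.degree u ≠ 1 ∧ G.degree v ≠ 1)

/-- The number of vertices of degree at least 2. -/
noncomputable def twoPlusCount {W : Type} [Fintype W] (H : SimpleGraph W) : ℕ :=
  (Finset.univ.filter (fun v : W => 2 ≤ H.degree v)).card

/-- A graph with maximum average degree less than `8/3` and maximum degree at most `Δ`. -/
def GoodA (Δ : ℕ) {W : Type} [Fintype W] (H : SimpleGraph W) : Prop :=
  mad H < 8 / 3 ∧ H.maxDegree ≤ Δ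

/-- `G` is a minimal counterexample to the bound `χ'_s ≤ 3Δ - 3` for graphs with
`Mad < 8/3` and maximum degree at most `Δ`. -/
def MinCexA (Δ : ℕ) {V : Type} [Fintype V] (G : SimpleGraph V) : Prop :=
  GoodA Δ G ∧ ¬ HasStrongColoring G (3 * Δ - 3) ∧
    ∀ (W : Type) [Fintype W] (H : SimpleGraph W), GoodA Δ H →
      (twoPlusCount H < twoPlusCount G ∨
        (twoPlusCount H = twoPlusCount G ∧ H.edgeSet.ncard < G.edgeSet.ncard)) →
      HasStrongColoring H (3 * Δ - 3)

/-! ### Finite-set combinatorics on the palette -/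

lemma two_hall {α : Type*} [DecidableEq α] (A B : Finset α) (n : ℕ) (hA : n ≤ A.card) (hB : n ≤ B.card)
    (hAB : 2 * n ≤ (A ∪ B).card) :
    ∃ P Q : Finset α, P ⊆ A ∧ Q ⊆ B ∧ Disjoint P Q ∧ P.card = n ∧ Q.card = n := by
  rcases le_total n (A \ B).card with h | h
  · obtain ⟨P, hP, hPc⟩ := Finset.exists_subset_card_eq h
    obtain ⟨Q, hQ, hQc⟩ := Finset.exists_subset_card_eq hB
    refine ⟨P, Q, fun x hx => (Finset.mem_sdiff.1 (hP hx)).1, hQ, ?_, hPc, hQc⟩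
    rw [Finset.disjoint_left]
    intro x hx hx'
    exact (Finset.mem_sdiff.1 (hP hx)).2 (hQ hx')
  · obtain ⟨P, hP1, hP2, hPc⟩ :=
      Finset.exists_subsuperset_card_eq (Finset.sdiff_subset (s := A) (t := B)) h hA
    have h1 : n ≤ ((A ∪ B) \ P).card := by
      have := Finset.le_card_sdiff P (A ∪ B)
      omega
    obtain ⟨Q, hQ, hQc⟩ := Finset.exists_subset_card_eq h1
    refine ⟨P, Q, hP2, ?_, ?_, hPc, hQc⟩
    · intro x hx
      have h2 := Finset.mem_sdiff.1 (hQ hx)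
      by_contra hxB
      rcases Finset.mem_union.1 h2.1 with h3 | h3
      · exact h2.2 (hP1 (Finset.mem_sdiff.2 ⟨h3, hxB⟩))
      · exact hxB h3
    · rw [Finset.disjoint_left]
      intro x hx hx'
      exact (Finset.mem_sdiff.1 (hQ hx')).2 hx

lemma card_univ_sdiff_ge {k : ℕ} (X : Finset (Fin k)) (m : ℕ) (h : X.card + m ≤ k) :
    m ≤ (Finset.univ \ X).card := by
  have := Finset.le_card_sdiff X Finset.univ
  rw [Finset.card_univ, Fintype.card_fin] at this
  omega

lemma comb1 (D : ℕ) (hD : 9 ≤ D) (X : Finset (Fin (3 * D - 3))) (hX : X.card = D)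
    (a : Fin (3 * D - 3)) (ha : a ∈ X) :
    ∃ U : Finset (Fin (3 * D - 3)), U.card = D ∧ U ∩ X = {a} := by
  obtain ⟨Q, hQ, hQc⟩ := Finset.exists_subset_card_eq
    (card_univ_sdiff_ge X (D - 1) (by omega))
  have hQX : ∀ x ∈ Q, x ∉ X := fun x hx => (Finset.mem_sdiff.1 (hQ hx)).2
  refine ⟨insert a Q, ?_, ?_⟩
  · rw [Finset.card_insert_of_notMem (fun h => hQX a h ha)]; omega
  · ext x; simp only [Finset.mem_inter, Finset.mem_insert, Finset.mem_singleton]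
    grind

lemma combV (D : ℕ) (hD : 9 ≤ D) (U W : Finset (Fin (3 * D - 3))) (hU : U.card = D)
    (hW : W.card = D) (p a c : Fin (3 * D - 3)) (hpU : p ∈ U) (hpW : p ∈ W)
    (haW : a ∈ W) (haU : a ∉ U) (hcU : c ∈ U) (hcW : c ∉ W) :
    ∃ T : Finset (Fin (3 * D - 3)), T.card = D ∧ T ∩ U = {c} ∧ T ∩ W = {a} := by
  have h1 : 1 ≤ (U ∩ W).card := Finset.card_pos.2 ⟨p, Finset.mem_inter.2 ⟨hpU, hpW⟩⟩
  have h2 := Finset.card_union_add_card_inter U W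
  obtain ⟨Q, hQ, hQc⟩ := Finset.exists_subset_card_eq
    (card_univ_sdiff_ge (U ∪ W) (D - 2) (by omega))
  have hQU : ∀ x ∈ Q, x ∉ U ∧ x ∉ W := fun x hx => by
    have := (Finset.mem_sdiff.1 (hQ hx)).2
    simpa using this
  refine ⟨insert a (insert c Q), ?_, ?_, ?_⟩
  · rw [Finset.card_insert_of_notMem, Finset.card_insert_of_notMem]
    · omega
    · exact fun h => (hQU c h).1 hcU
    · intro h
      rcases Finset.mem_insert.1 h with h | h
      · exact haU (h ▸ hcU)
      · exact (hQU a h).2 haW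
  · ext x; simp only [Finset.mem_inter, Finset.mem_insert, Finset.mem_singleton]
    grind
  · ext x; simp only [Finset.mem_inter, Finset.mem_insert, Finset.mem_singleton]
    grind

lemma comb2 (D : ℕ) (hD : 9 ≤ D) (X Y FX FY : Finset (Fin (3 * D - 3))) (hX : X.card = D)
    (hY : Y.card = D) (hFX : FX ⊆ X) (hFY : FY ⊆ Y) (h3 : 3 ≤ FX.card) (h1 : 1 ≤ FY.card) :
    ∃ (a b c : Fin (3 * D - 3)) (U T : Finset (Fin (3 * D - 3))), a ∈ FX ∧ b ∈ FY ∧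
      U.card = D ∧ T.card = D ∧ U ∩ X = {a} ∧ T ∩ Y = {b} ∧ T ∩ U = {c} ∧
      c ∉ X ∧ c ∉ Y ∧ b ∉ U := by
  obtain ⟨b, hb⟩ := Finset.card_pos.1 h1
  have hIle : (X ∩ Y).card ≤ D :=
    (Finset.card_le_card Finset.inter_subset_left).trans hX.le
  -- choose `a`
  have key : ∃ a ∈ FX, a ≠ b ∧ ((X ∩ Y) ∪ {a, b}).card ≤ D := by
    by_cases hc : (X ∩ Y).card + 2 ≤ D
    · have : 0 < (FX \ {b}).card := by
        have := Finset.le_card_sdiff {b} FX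
        rw [Finset.card_singleton] at this
        omega
      obtain ⟨a, ha⟩ := Finset.card_pos.1 this
      rw [Finset.mem_sdiff, Finset.mem_singleton] at ha
      refine ⟨a, ha.1, ha.2, ?_⟩
      have h4 := Finset.card_union_le (X ∩ Y) {a, b}
      have h5 := Finset.card_le_two (a := a) (b := b)
      omega
    · have h6 : (X \ Y).card ≤ 1 := by
        have := Finset.card_sdiff_add_card_inter X Y
        omega
      have : 0 < ((FX \ {b}) \ (X \ Y)).card := by
        have h7 := Finset.le_card_sdiff {b} FX
        have h8 := Finset.le_card_sdiff (X \ Y) (FX \ {b})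
        rw [Finset.card_singleton] at h7
        omega
      obtain ⟨a, ha⟩ := Finset.card_pos.1 this
      simp only [Finset.mem_sdiff, Finset.mem_singleton, not_and, not_not] at ha
      refine ⟨a, ha.1.1, ha.1.2, ?_⟩
      have haY : a ∈ Y := ha.2 (hFX ha.1.1)
      calc ((X ∩ Y) ∪ {a, b}).card ≤ Y.card := Finset.card_le_card (by
            intro x hx
            simp only [Finset.mem_union, Finset.mem_inter, Finset.mem_insert,
              Finset.mem_singleton] at hx
            rcases hx with hx | rfl | rfl
            · exact hx.2
            · exact haY
            · exact hFY hb)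
        _ = D := hY
  obtain ⟨a, ha, hab, hcard⟩ := key
  obtain ⟨c, hc⟩ := Finset.card_pos.1 (lt_of_lt_of_le Nat.zero_lt_one
    (card_univ_sdiff_ge (X ∪ Y) 1 (by
      have := Finset.card_union_le X Y
      omega)))
  have hc' : c ∉ X ∧ c ∉ Y := by simpa using hc
  have haX := hFX ha
  have hbY := hFY hb
  have hA : D - 2 ≤ (Finset.univ \ (X ∪ {b, c})).card := by
    apply card_univ_sdiff_ge
    have h4 := Finset.card_union_le X {b, c}
    have h5 := Finset.card_le_two (a := b) (b := c)
    omega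
  have hB : D - 2 ≤ (Finset.univ \ (Y ∪ {a, c})).card := by
    apply card_univ_sdiff_ge
    have h4 := Finset.card_union_le Y {a, c}
    have h5 := Finset.card_le_two (a := a) (b := c)
    omega
  have hAB : 2 * (D - 2) ≤ ((Finset.univ \ (X ∪ {b, c})) ∪ (Finset.univ \ (Y ∪ {a, c}))).card := by
    have h6 : 2 * (D - 2) ≤ (Finset.univ \ (((X ∩ Y) ∪ {a, b}) ∪ {c})).card := by
      apply card_univ_sdiff_ge
      have h4 := Finset.card_union_le ((X ∩ Y) ∪ {a, b}) {c}
      rw [Finset.card_singleton] at h4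
      omega
    refine h6.trans (Finset.card_le_card ?_)
    intro x hx
    simp only [Finset.mem_union, Finset.mem_sdiff, Finset.mem_univ, true_and, Finset.mem_inter,
      Finset.mem_insert, Finset.mem_singleton] at hx ⊢
    tauto
  obtain ⟨P, Q, hP, hQ, hPQ, hPc, hQc⟩ := two_hall _ _ _ hA hB hAB
  have hP' : ∀ x ∈ P, x ∉ X ∧ x ≠ b ∧ x ≠ c := fun x hx => by
    have := hP hx
    simp only [Finset.mem_sdiff, Finset.mem_univ, true_and, Finset.mem_union, Finset.mem_insert,
      Finset.mem_singleton, not_or] at this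
    exact this
  have hQ' : ∀ x ∈ Q, x ∉ Y ∧ x ≠ a ∧ x ≠ c := fun x hx => by
    have := hQ hx
    simp only [Finset.mem_sdiff, Finset.mem_univ, true_and, Finset.mem_union, Finset.mem_insert,
      Finset.mem_singleton, not_or] at this
    exact this
  rw [Finset.disjoint_left] at hPQ
  refine ⟨a, b, c, insert a (insert c P), insert b (insert c Q), ha, hb, ?_, ?_, ?_, ?_, ?_,
    hc'.1, hc'.2, ?_⟩
  · rw [Finset.card_insert_of_notMem, Finset.card_insert_of_notMem]
    · omega
    · grind
    · grind
  · rw [Finset.card_insert_of_notMem, Finset.card_insert_of_notMem]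
    · omega
    · grind
    · grind
  · ext x; simp only [Finset.mem_inter, Finset.mem_insert, Finset.mem_singleton]
    grind
  · ext x; simp only [Finset.mem_inter, Finset.mem_insert, Finset.mem_singleton]
    grind
  · ext x; simp only [Finset.mem_inter, Finset.mem_insert, Finset.mem_singleton]
    grind
  · grind

set_option maxHeartbeats 1000000 in
lemma comb3 (D : ℕ) (hD : 9 ≤ D) (Z W1 W2 FZ F1 F2 : Finset (Fin (3 * D - 3)))
    (hZ : Z.card = D) (hW1 : W1.card = D) (hW2 : W2.card = D)
    (hFZ : FZ ⊆ Z) (hF1 : F1 ⊆ W1) (hF2 : F2 ⊆ W2)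
    (hz : 1 ≤ FZ.card) (h1 : 3 ≤ F1.card) (h2 : 3 ≤ F2.card)
    (p : Prop) (hp : p → W1 = W2 ∧ F1 = F2 ∧ 4 ≤ F1.card) :
    ∃ (e a1 a2 c1 c2 : Fin (3 * D - 3)) (U T1 T2 : Finset (Fin (3 * D - 3))),
      e ∈ FZ ∧ a1 ∈ F1 ∧ a2 ∈ F2 ∧ U.card = D ∧ T1.card = D ∧ T2.card = D ∧
      U ∩ Z = {e} ∧ T1 ∩ U = {c1} ∧ T2 ∩ U = {c2} ∧ T1 ∩ W1 = {a1} ∧ T2 ∩ W2 = {a2} ∧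
      c1 ≠ c2 ∧ c1 ∉ Z ∧ c2 ∉ Z ∧ c1 ∉ W1 ∧ c2 ∉ W2 ∧ a1 ∉ U ∧ a2 ∉ U ∧ (p → a1 ≠ a2) := by
  obtain ⟨e, he⟩ := Finset.card_pos.1 hz
  have heZ := hFZ he
  have hT : ∀ W : Finset (Fin (3 * D - 3)), W.card = D → ∃ t ∈ W, t = e ∨ t ∉ Z := by
    intro W hW
    by_contra hcon
    push Not at hcon
    have hsub : W ⊆ Z := fun t ht => (hcon t ht).2
    have heq : W = Z := Finset.eq_of_subset_of_card_le hsub (by omega)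
    exact (hcon e (heq ▸ heZ)).1 rfl
  have hpa : ∃ p1 p2 a1 a2, p1 ∈ W1 ∧ p2 ∈ W2 ∧ (p1 = e ∨ p1 ∉ Z) ∧ (p2 = e ∨ p2 ∉ Z) ∧
      a1 ∈ F1 ∧ a2 ∈ F2 ∧ a1 ≠ e ∧ a1 ≠ p1 ∧ a1 ≠ p2 ∧ a2 ≠ e ∧ a2 ≠ p1 ∧ a2 ≠ p2 ∧
      (p → a1 ≠ a2) := by
    by_cases hcom : ∃ t, t ∈ W1 ∧ t ∈ W2 ∧ (t = e ∨ t ∉ Z)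
    · obtain ⟨t, ht1, ht2, ht⟩ := hcom
      have h5 := Finset.card_le_two (a := e) (b := t)
      have h6 := Finset.le_card_sdiff {e, t} F2
      obtain ⟨a2, ha2⟩ := Finset.card_pos.1 (show 0 < (F2 \ {e, t}).card by omega)
      have hex : ∃ a1 ∈ F1, a1 ≠ e ∧ a1 ≠ t ∧ (p → a1 ≠ a2) := by
        by_cases hpp : p
        · obtain ⟨-, -, h4⟩ := hp hpp
          have h7 := Finset.le_card_sdiff {e, t, a2} F1
          have h8 := Finset.card_le_three (a := e) (b := t) (c := a2)
          obtain ⟨a1, ha1⟩ := Finset.card_pos.1 (show 0 < (F1 \ {e, t, a2}).card by omega)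
          simp at ha1
          exact ⟨a1, ha1.1, ha1.2.1, ha1.2.2.1, fun _ => ha1.2.2.2⟩
        · have h7 := Finset.le_card_sdiff {e, t} F1
          obtain ⟨a1, ha1⟩ := Finset.card_pos.1 (show 0 < (F1 \ {e, t}).card by omega)
          simp at ha1
          exact ⟨a1, ha1.1, ha1.2.1, ha1.2.2, fun h => absurd h hpp⟩
      obtain ⟨a1, hh1, hh2, hh3, hh4⟩ := hex
      simp at ha2
      exact ⟨t, t, a1, a2, ht1, ht2, ht, ht, hh1, ha2.1, hh2, hh3, hh3, ha2.2.1, ha2.2.2,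
        ha2.2.2, hh4⟩
    · push Not at hcom
      obtain ⟨p1, hp1, hp1'⟩ := hT W1 hW1
      obtain ⟨p2, hp2, hp2'⟩ := hT W2 hW2
      have hp1W : p1 ∉ W2 := fun h => by have := hcom p1 hp1 h; tauto
      have hp2W : p2 ∉ W1 := fun h => by have := hcom p2 h hp2; tauto
      have hnp : ¬ p := fun h => hp1W ((hp h).1 ▸ hp1)
      have h6 := Finset.le_card_sdiff {e, p1} F1
      have h7 := Finset.le_card_sdiff {e, p2} F2
      have h8 := Finset.card_le_two (a := e) (b := p1)
      have h9 := Finset.card_le_two (a := e) (b := p2)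
      obtain ⟨a1, ha1⟩ := Finset.card_pos.1 (show 0 < (F1 \ {e, p1}).card by omega)
      obtain ⟨a2, ha2⟩ := Finset.card_pos.1 (show 0 < (F2 \ {e, p2}).card by omega)
      simp at ha1 ha2
      exact ⟨p1, p2, a1, a2, hp1, hp2, hp1', hp2', ha1.1, ha2.1, ha1.2.1, ha1.2.2,
        fun h => hp2W (h ▸ hF1 ha1.1), ha2.2.1, fun h => hp1W (h ▸ hF2 ha2.1), ha2.2.2,
        fun h => absurd h hnp⟩
  obtain ⟨p1, p2, a1, a2, hp1W, hp2W, hp1, hp2, ha1, ha2, ha1e, ha1p1, ha1p2, ha2e, ha2p1,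
    ha2p2, hpne⟩ := hpa
  have hc1 : 1 ≤ (Finset.univ \ (Z ∪ W1 ∪ {a1, a2})).card := by
    apply card_univ_sdiff_ge
    have h4 := Finset.card_union_le Z W1
    have h5 := Finset.card_union_le (Z ∪ W1) {a1, a2}
    have h6 := Finset.card_le_two (a := a1) (b := a2)
    omega
  obtain ⟨c1, hc1⟩ := Finset.card_pos.1 hc1
  have hc2 : 1 ≤ (Finset.univ \ (Z ∪ W2 ∪ {a1, a2, c1})).card := by
    apply card_univ_sdiff_ge
    have h4 := Finset.card_union_le Z W2
    have h5 := Finset.card_union_le (Z ∪ W2) {a1, a2, c1}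
    have h6 := Finset.card_le_three (a := a1) (b := a2) (c := c1)
    omega
  obtain ⟨c2, hc2⟩ := Finset.card_pos.1 hc2
  simp only [Finset.mem_sdiff, Finset.mem_univ, true_and, Finset.mem_union, Finset.mem_insert,
    Finset.mem_singleton, not_or] at hc1 hc2
  obtain ⟨⟨hc1Z, hc1W⟩, hc1a1, hc1a2⟩ := hc1
  obtain ⟨⟨hc2Z, hc2W⟩, hc2a1, hc2a2, hc21⟩ := hc2
  have hsub : ({e, p1, p2, c1, c2} : Finset (Fin (3 * D - 3))) ⊆
      insert e (Finset.univ \ (Z ∪ {a1, a2})) := by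
    intro x hx
    simp only [Finset.mem_sdiff, Finset.mem_univ, true_and, Finset.mem_union, Finset.mem_insert,
      Finset.mem_singleton, not_or] at hx ⊢
    grind
  have hle : ({e, p1, p2, c1, c2} : Finset (Fin (3 * D - 3))).card ≤ D :=
    Finset.card_le_five.trans (by omega)
  have hge : D ≤ (insert e (Finset.univ \ (Z ∪ {a1, a2}))).card := by
    have h3 : D ≤ (Finset.univ \ (Z ∪ {a1, a2})).card := by
      apply card_univ_sdiff_ge
      have h5 := Finset.card_union_le Z {a1, a2}
      have h6 := Finset.card_le_two (a := a1) (b := a2)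
      omega
    exact h3.trans (Finset.card_le_card (Finset.subset_insert _ _))
  obtain ⟨U, hU1, hU2, hUc⟩ := Finset.exists_subsuperset_card_eq hsub hle hge
  have hmem : ∀ x ∈ U, x = e ∨ (x ∉ Z ∧ x ≠ a1 ∧ x ≠ a2) := by
    intro x hx
    have := hU2 hx
    simp only [Finset.mem_sdiff, Finset.mem_univ, true_and, Finset.mem_union, Finset.mem_insert,
      Finset.mem_singleton, not_or] at this
    exact this
  have heU : e ∈ U := hU1 (by simp)
  have hp1U : p1 ∈ U := hU1 (by simp)
  have hp2U : p2 ∈ U := hU1 (by simp)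
  have hc1U : c1 ∈ U := hU1 (by simp)
  have hc2U : c2 ∈ U := hU1 (by simp)
  have ha1U : a1 ∉ U := fun h => (hmem a1 h).elim ha1e (fun h' => h'.2.1 rfl)
  have ha2U : a2 ∉ U := fun h => (hmem a2 h).elim ha2e (fun h' => h'.2.2 rfl)
  obtain ⟨T1, hT1, hT1U, hT1W⟩ := combV D hD U W1 hUc hW1 p1 a1 c1 hp1U hp1W (hF1 ha1) ha1U
    hc1U hc1W
  obtain ⟨T2, hT2, hT2U, hT2W⟩ := combV D hD U W2 hUc hW2 p2 a2 c2 hp2U hp2W (hF2 ha2) ha2U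
    hc2U hc2W
  refine ⟨e, a1, a2, c1, c2, U, T1, T2, he, ha1, ha2, hUc, hT1, hT2, ?_, hT1U, hT2U, hT1W,
    hT2W, fun h => hc21 h.symm, hc1Z, hc2Z, hc1W, hc2W, ha1U, ha2U, hpne⟩
  ext x
  simp only [Finset.mem_inter, Finset.mem_singleton]
  constructor
  · rintro ⟨h, h'⟩
    rcases hmem x h with h3 | h3
    · exact h3
    · exact absurd h' h3.1
  · rintro rfl
    exact ⟨heU, heZ⟩

/-! ### Palettes on vertex subsets -/

/-- A system of palettes of size `D` on the vertices of `A`: adjacent palettes share exactly one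
color, and the colors shared by a vertex with distinct neighbors are distinct. -/
def Good {V : Type} (G : SimpleGraph V) (D : ℕ) (A : Finset V)
    (S : V → Finset (Fin (3 * D - 3))) : Prop :=
  (∀ v ∈ A, (S v).card = D) ∧
  (∀ u ∈ A, ∀ v ∈ A, G.Adj u v → ∃ c, S u ∩ S v = {c}) ∧
  (∀ v ∈ A, ∀ u ∈ A, ∀ w ∈ A, G.Adj v u → G.Adj v w → u ≠ w →
    ∀ c, c ∈ S u → c ∈ S v → c ∉ S w)

/-- Neighbors of `v` inside `A`. -/
noncomputable def nb {V : Type} (G : SimpleGraph V) (A : Finset V) (v : V) : Finset V :=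
  A.filter (fun w => G.Adj v w)

/-- Colors of the palette of `x` that are not shared with any neighbor of `x` inside `A`. -/
noncomputable def free {V : Type} (G : SimpleGraph V) (D : ℕ) (A : Finset V)
    (S : V → Finset (Fin (3 * D - 3))) (x : V) : Finset (Fin (3 * D - 3)) :=
  (S x).filter (fun c => ∀ t ∈ A, G.Adj x t → c ∉ S t)

lemma mem_nb {V : Type} {G : SimpleGraph V} {A : Finset V} {v w : V} :
    w ∈ nb G A v ↔ w ∈ A ∧ G.Adj v w := by
  simp [nb]

lemma free_sub {V : Type} (G : SimpleGraph V) (D : ℕ) (A : Finset V)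
    (S : V → Finset (Fin (3 * D - 3))) (x : V) : free G D A S x ⊆ S x :=
  Finset.filter_subset _ _

lemma free_spec {V : Type} {G : SimpleGraph V} {D : ℕ} {A : Finset V}
    {S : V → Finset (Fin (3 * D - 3))} {x : V} {c : Fin (3 * D - 3)}
    (h : c ∈ free G D A S x) : ∀ t ∈ A, G.Adj x t → c ∉ S t :=
  (Finset.mem_filter.1 h).2

lemma free_card {V : Type} {G : SimpleGraph V} {D : ℕ} {A : Finset V}
    {S : V → Finset (Fin (3 * D - 3))} (hS : Good G D A S) {x : V} (hx : x ∈ A) :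
    D ≤ (free G D A S x).card + (nb G A x).card := by
  have h1 : S x ⊆ free G D A S x ∪ (nb G A x).biUnion (fun t => S x ∩ S t) := by
    intro c hc
    by_cases hf : c ∈ free G D A S x
    · exact Finset.mem_union_left _ hf
    · apply Finset.mem_union_right
      simp only [free, Finset.mem_filter, not_and, not_forall, not_not] at hf
      obtain ⟨t, ht, hxt, hct⟩ := hf hc
      rw [Finset.mem_biUnion]
      exact ⟨t, mem_nb.2 ⟨ht, hxt⟩, Finset.mem_inter.2 ⟨hc, hct⟩⟩
  have h2 : ((nb G A x).biUnion (fun t => S x ∩ S t)).card ≤ (nb G A x).card * 1 := by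
    apply Finset.card_biUnion_le_card_mul
    intro t ht
    obtain ⟨ht, hxt⟩ := mem_nb.1 ht
    obtain ⟨c, hc⟩ := hS.2.1 x hx t ht hxt
    rw [hc, Finset.card_singleton]
  have h3 := Finset.card_le_card h1
  have h4 := Finset.card_union_le (free G D A S x) ((nb G A x).biUnion (fun t => S x ∩ S t))
  have h5 := hS.1 x hx
  omega

lemma good_insert {V : Type} {G : SimpleGraph V} {D : ℕ} {A : Finset V}
    {S : V → Finset (Fin (3 * D - 3))} (hS : Good G D A S) {u : V} (hu : u ∉ A)
    (U : Finset (Fin (3 * D - 3))) (hU : U.card = D)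
    (h : ∀ x ∈ A, G.Adj u x → ∃ e, U ∩ S x = {e} ∧ (∀ t ∈ A, G.Adj x t → e ∉ S t) ∧
      (∀ y ∈ A, G.Adj u y → y ≠ x → e ∉ S y)) :
    ∃ S' : V → Finset (Fin (3 * D - 3)), Good G D (insert u A) S' ∧ S' u = U ∧
      ∀ t, t ≠ u → S' t = S t := by
  have hne : ∀ t ∈ A, t ≠ u := fun t ht h => hu (h ▸ ht)
  refine ⟨Function.update S u U, ⟨?_, ?_, ?_⟩, by simp, fun t ht => by simp [ht]⟩
  · intro v hv
    rcases Finset.mem_insert.1 hv with rfl | hv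
    · simpa using hU
    · simpa [hne v hv] using hS.1 v hv
  · intro x hx y hy hxy
    rcases Finset.mem_insert.1 hx with hxu | hx' <;> rcases Finset.mem_insert.1 hy with hyu | hy'
    · exact absurd (hxu.trans hyu.symm) hxy.ne
    · subst hxu
      obtain ⟨e, he, -⟩ := h y hy' hxy
      exact ⟨e, by simpa [hne y hy'] using he⟩
    · subst hyu
      obtain ⟨e, he, -⟩ := h x hx' hxy.symm
      refine ⟨e, ?_⟩
      rw [Finset.inter_comm]
      simpa [hne x hx'] using he
    · simpa [hne x hx', hne y hy'] using hS.2.1 x hx' y hy' hxy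
  · intro v hv x hx y hy hvx hvy hxy c hcx hcv hcy
    have aux : ∀ {P Q : Finset (Fin (3 * D - 3))} {e c}, P ∩ Q = {e} → c ∈ P → c ∈ Q → c = e := by
      intro P Q e c hPQ hP hQ
      have : c ∈ P ∩ Q := Finset.mem_inter.2 ⟨hP, hQ⟩
      rw [hPQ] at this
      exact Finset.mem_singleton.1 this
    rcases Finset.mem_insert.1 hv with hvu | hv'
    · subst hvu
      have hx' : x ∈ A := (Finset.mem_insert.1 hx).resolve_left hvx.ne.symm
      have hy' : y ∈ A := (Finset.mem_insert.1 hy).resolve_left hvy.ne.symm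
      simp [hne x hx', hne y hy'] at hcx hcv hcy
      obtain ⟨e, he, -, he2⟩ := h x hx' hvx
      have := aux he hcv hcx
      subst this
      exact he2 y hy' hvy (Ne.symm hxy) hcy
    · rcases Finset.mem_insert.1 hx with hxu | hx'
      · subst hxu
        have hy' : y ∈ A := (Finset.mem_insert.1 hy).resolve_left (Ne.symm hxy)
        simp [hne v hv', hne y hy'] at hcx hcv hcy
        obtain ⟨e, he, he1, -⟩ := h v hv' hvx.symm
        have := aux he hcx hcv
        subst this
        exact he1 y hy' hvy hcy
      · rcases Finset.mem_insert.1 hy with hyu | hy'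
        · subst hyu
          simp [hne v hv', hne x hx'] at hcx hcv hcy
          obtain ⟨e, he, he1, -⟩ := h v hv' hvy.symm
          have := aux he hcy hcv
          subst this
          exact he1 x hx' hvx hcx
        · simp [hne v hv', hne x hx', hne y hy'] at hcx hcv hcy
          exact hS.2.2 v hv' x hx' y hy' hvx hvy hxy c hcx hcv hcy

lemma nb_card_lt {V : Type} {G : SimpleGraph V} {A B : Finset V} {x u : V} (hBA : B ⊆ A)
    (hu : u ∈ A) (hxu : G.Adj x u) (huB : u ∉ B) :
    (nb G B x).card + 1 ≤ (nb G A x).card := by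
  apply Finset.card_lt_card
  rw [Finset.ssubset_iff_of_subset]
  · exact ⟨u, mem_nb.2 ⟨hu, hxu⟩, fun h => huB (mem_nb.1 h).1⟩
  · intro t ht
    exact mem_nb.2 ⟨hBA (mem_nb.1 ht).1, (mem_nb.1 ht).2⟩

lemma nb_card_lt2 {V : Type} {G : SimpleGraph V} {A B : Finset V} {x u v : V} (hBA : B ⊆ A)
    (hu : u ∈ A) (hxu : G.Adj x u) (huB : u ∉ B)
    (hv : v ∈ A) (hxv : G.Adj x v) (hvB : v ∉ B) (huv : u ≠ v) :
    (nb G B x).card + 2 ≤ (nb G A x).card := by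
  have h1 := nb_card_lt (G := G) (A := insert u B) (B := B) (x := x) (u := u)
    (Finset.subset_insert _ _) (Finset.mem_insert_self _ _) hxu huB
  have h2 := nb_card_lt (G := G) (A := A) (B := insert u B) (x := x) (u := v)
    (Finset.insert_subset hu hBA) hv hxv (by simp [huv.symm, hvB])
  omega

/-- Removing a vertex with at most one neighbor. -/
lemma red1 {V : Type} {G : SimpleGraph V} {D : ℕ} (hD : 9 ≤ D) {A : Finset V}
    (hmax : ∀ v, (nb G A v).card ≤ D)
    (ih : ∀ B, B ⊂ A → ∃ S, Good G D B S) {u : V} (hu : u ∈ A) (hd : (nb G A u).card ≤ 1) :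
    ∃ S, Good G D A S := by
  obtain ⟨S, hS⟩ := ih (A.erase u) (Finset.erase_ssubset hu)
  have huB : u ∉ A.erase u := Finset.notMem_erase u A
  have hex : ∃ U : Finset (Fin (3 * D - 3)), U.card = D ∧
      ∀ x ∈ A.erase u, G.Adj u x → ∃ e, U ∩ S x = {e} ∧
        (∀ t ∈ A.erase u, G.Adj x t → e ∉ S t) := by
    rcases Finset.eq_empty_or_nonempty (nb G A u) with h0 | ⟨x, hx⟩
    · obtain ⟨U, -, hU⟩ := Finset.exists_subset_card_eq
        (card_univ_sdiff_ge (∅ : Finset (Fin (3 * D - 3))) D (by simp; omega))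
      refine ⟨U, hU, fun x hx hux => ?_⟩
      have : x ∈ nb G A u := mem_nb.2 ⟨Finset.mem_of_mem_erase hx, hux⟩
      rw [h0] at this
      exact absurd this (Finset.notMem_empty _)
    · obtain ⟨hxA, hux⟩ := mem_nb.1 hx
      have hxB : x ∈ A.erase u := Finset.mem_erase.2 ⟨hux.ne.symm, hxA⟩
      have h1 := free_card hS hxB
      have h2 := nb_card_lt (Finset.erase_subset u A) hu hux.symm huB
      have h3 := hmax x
      obtain ⟨a, ha⟩ := Finset.card_pos.1 (show 0 < (free G D (A.erase u) S x).card by omega)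
      obtain ⟨U, hU, hUX⟩ := comb1 D hD (S x) (hS.1 x hxB) a (free_sub _ _ _ _ _ ha)
      refine ⟨U, hU, fun y hy huy => ?_⟩
      have : y = x := Finset.card_le_one.1 hd y
        (mem_nb.2 ⟨Finset.mem_of_mem_erase hy, huy⟩) x hx
      subst this
      exact ⟨a, hUX, free_spec ha⟩
  obtain ⟨U, hU, hh⟩ := hex
  obtain ⟨S', hS', -⟩ := good_insert hS huB U hU (fun x hx hux => by
    obtain ⟨e, h1, h2⟩ := hh x hx hux
    refine ⟨e, h1, h2, fun y hy huy hyx => ?_⟩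
    exact absurd (Finset.card_le_one.1 hd y
        (mem_nb.2 ⟨Finset.mem_of_mem_erase hy, huy⟩) x
        (mem_nb.2 ⟨Finset.mem_of_mem_erase hx, hux⟩)) hyx)
  rw [Finset.insert_erase hu] at hS'
  exact ⟨S', hS'⟩

/-- Removing two adjacent 2-vertices, one of which has its other neighbor of degree at most 7. -/
lemma red2 {V : Type} {G : SimpleGraph V} {D : ℕ} (hD : 9 ≤ D) {A : Finset V}
    (hmax : ∀ v, (nb G A v).card ≤ D)
    (ih : ∀ B, B ⊂ A → ∃ S, Good G D B S) {u v x y : V} (hu : u ∈ A) (hv : v ∈ A)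
    (huv : G.Adj u v) (hxv : x ≠ v) (hyu : y ≠ u)
    (hnu : ∀ t, t ∈ nb G A u ↔ t = v ∨ t = x) (hnv : ∀ t, t ∈ nb G A v ↔ t = u ∨ t = y)
    (hx7 : (nb G A x).card ≤ 7) :
    ∃ S, Good G D A S := by
  obtain ⟨hxA, hux⟩ := mem_nb.1 ((hnu x).2 (Or.inr rfl))
  obtain ⟨hyA, hvy⟩ := mem_nb.1 ((hnv y).2 (Or.inr rfl))
  set B := (A.erase v).erase u with hB
  have hmB : ∀ t, t ∈ B ↔ t ∈ A ∧ t ≠ v ∧ t ≠ u := by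
    intro t; simp only [hB, Finset.mem_erase]; tauto
  have hBA : B ⊆ A := fun t ht => ((hmB t).1 ht).1
  have huB : u ∉ B := fun h => ((hmB u).1 h).2.2 rfl
  have hvB : v ∉ B := fun h => ((hmB v).1 h).2.1 rfl
  obtain ⟨S, hS⟩ := ih B ((Finset.ssubset_iff_of_subset hBA).2 ⟨u, hu, huB⟩)
  have hxB : x ∈ B := (hmB x).2 ⟨hxA, hxv, hux.ne.symm⟩
  have hyB : y ∈ B := (hmB y).2 ⟨hyA, hvy.ne.symm, hyu⟩
  have h1 := free_card hS hxB
  have h2 := nb_card_lt hBA hu hux.symm huB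
  have h3 := free_card hS hyB
  have h4 := nb_card_lt hBA hv hvy.symm hvB
  have h5 := hmax y
  obtain ⟨a, b, c, U, T, ha, hb, hU, hT, hUX, hTY, hTU, hcX, hcY, hbU⟩ :=
    comb2 D hD (S x) (S y) (free G D B S x) (free G D B S y) (hS.1 x hxB) (hS.1 y hyB)
      (free_sub _ _ _ _ _) (free_sub _ _ _ _ _) (by omega) (by omega)
  obtain ⟨S1, hS1, hS1u, hS1t⟩ := good_insert hS huB U hU (by
    intro t ht hut
    have htx : t = x := ((hnu t).1 (mem_nb.2 ⟨hBA ht, hut⟩)).resolve_left ((hmB t).1 ht).2.1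
    subst htx
    refine ⟨a, hUX, free_spec ha, fun y' hy' huy' hne => ?_⟩
    exact absurd (((hnu y').1 (mem_nb.2 ⟨hBA hy', huy'⟩)).resolve_left ((hmB y').1 hy').2.1) hne)
  have hvB1 : v ∉ insert u B := by simp [hvB, huv.ne.symm]
  have hB1 : insert u B ⊆ A := Finset.insert_subset hu hBA
  obtain ⟨S2, hS2, -⟩ := good_insert hS1 hvB1 T hT (by
    intro t ht hvt
    rcases (hnv t).1 (mem_nb.2 ⟨hB1 ht, hvt⟩) with rfl | rfl
    · refine ⟨c, by rw [hS1u]; exact hTU, fun s hs hts => ?_, fun s hs hvs hst => ?_⟩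
      · have hs' : s = x := by
          refine ((hnu s).1 (mem_nb.2 ⟨hB1 hs, hts⟩)).resolve_left ?_
          rintro rfl; exact hvB1 hs
        subst hs'
        rw [hS1t _ hux.ne.symm]; exact hcX
      · have hs' : s = y := ((hnv s).1 (mem_nb.2 ⟨hB1 hs, hvs⟩)).resolve_left hst
        subst hs'
        rw [hS1t _ hyu]; exact hcY
    · refine ⟨b, by rw [hS1t _ hyu]; exact hTY, fun s hs hts => ?_, fun s hs hvs hst => ?_⟩
      · rcases Finset.mem_insert.1 hs with rfl | hs
        · rw [hS1u]; exact hbU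
        · rw [hS1t _ (fun h => huB (h ▸ hs))]; exact free_spec hb s hs hts
      · have hs' : s = u := ((hnv s).1 (mem_nb.2 ⟨hB1 hs, hvs⟩)).resolve_right hst
        subst hs'
        rw [hS1u]; exact hbU)
  have : insert v (insert u B) = A := by
    ext t; simp only [Finset.mem_insert, hmB]
    constructor
    · rintro (rfl | rfl | h)
      exacts [hv, hu, h.1]
    · intro h; tauto
  rw [this] at hS2
  exact ⟨S2, hS2⟩

/-- Removing a 3-vertex with two 2-neighbors when all other vertices around have degree at most
7. -/
lemma red3 {V : Type} {G : SimpleGraph V} {D : ℕ} (hD : 9 ≤ D) {A : Finset V}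
    (ih : ∀ B, B ⊂ A → ∃ S, Good G D B S) {u v1 v2 z w1 w2 : V} (hu : u ∈ A)
    (hv12 : v1 ≠ v2) (hz1 : z ≠ v1) (hz2 : z ≠ v2)
    (hw1u : w1 ≠ u) (hw2u : w2 ≠ u) (hw1v : w1 ≠ v2) (hw2v : w2 ≠ v1)
    (hnu : ∀ t, t ∈ nb G A u ↔ t = v1 ∨ t = v2 ∨ t = z)
    (hn1 : ∀ t, t ∈ nb G A v1 ↔ t = u ∨ t = w1)
    (hn2 : ∀ t, t ∈ nb G A v2 ↔ t = u ∨ t = w2)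
    (hz7 : (nb G A z).card ≤ 7) (hw17 : (nb G A w1).card ≤ 7) (hw27 : (nb G A w2).card ≤ 7) :
    ∃ S, Good G D A S := by
  obtain ⟨hv1, huv1⟩ := mem_nb.1 ((hnu v1).2 (by simp))
  obtain ⟨hv2, huv2⟩ := mem_nb.1 ((hnu v2).2 (by simp))
  obtain ⟨hzA, huz⟩ := mem_nb.1 ((hnu z).2 (by simp))
  obtain ⟨hw1A, hvw1⟩ := mem_nb.1 ((hn1 w1).2 (by simp))
  obtain ⟨hw2A, hvw2⟩ := mem_nb.1 ((hn2 w2).2 (by simp))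
  set B := ((A.erase v1).erase v2).erase u with hB
  have hmB : ∀ t, t ∈ B ↔ t ∈ A ∧ t ≠ v1 ∧ t ≠ v2 ∧ t ≠ u := by
    intro t; simp only [hB, Finset.mem_erase]; tauto
  have hBA : B ⊆ A := fun t ht => ((hmB t).1 ht).1
  have huB : u ∉ B := fun h => ((hmB u).1 h).2.2.2 rfl
  have hv1B : v1 ∉ B := fun h => ((hmB v1).1 h).2.1 rfl
  have hv2B : v2 ∉ B := fun h => ((hmB v2).1 h).2.2.1 rfl
  obtain ⟨S, hS⟩ := ih B ((Finset.ssubset_iff_of_subset hBA).2 ⟨u, hu, huB⟩)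
  have hzB : z ∈ B := (hmB z).2 ⟨hzA, hz1, hz2, huz.ne.symm⟩
  have hw1B : w1 ∈ B := (hmB w1).2 ⟨hw1A, hvw1.ne.symm, hw1v, hw1u⟩
  have hw2B : w2 ∈ B := (hmB w2).2 ⟨hw2A, hw2v, hvw2.ne.symm, hw2u⟩
  have h1 := free_card hS hzB
  have h2 := nb_card_lt hBA hu huz.symm huB
  have h3 := free_card hS hw1B
  have h4 := nb_card_lt hBA hv1 hvw1.symm hv1B
  have h5 := free_card hS hw2B
  have h6 := nb_card_lt hBA hv2 hvw2.symm hv2B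
  obtain ⟨e, a1, a2, c1, c2, U, T1, T2, he, ha1, ha2, hU, hT1, hT2, hUZ, hT1U, hT2U, hT1W, hT2W,
      hc12, hc1Z, hc2Z, hc1W, hc2W, ha1U, ha2U, hane⟩ :=
    comb3 D hD (S z) (S w1) (S w2) (free G D B S z) (free G D B S w1) (free G D B S w2)
      (hS.1 z hzB) (hS.1 w1 hw1B) (hS.1 w2 hw2B)
      (free_sub _ _ _ _ _) (free_sub _ _ _ _ _) (free_sub _ _ _ _ _)
      (by omega) (by omega) (by omega) (w1 = w2) (by
        rintro rfl
        have h7 := nb_card_lt2 hBA hv1 hvw1.symm hv1B hv2 hvw2.symm hv2B hv12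
        exact ⟨rfl, rfl, by omega⟩)
  -- insert `u`
  have hnuB : ∀ t ∈ B, G.Adj u t → t = z := by
    intro t ht hut
    have h := (hnu t).1 (mem_nb.2 ⟨hBA ht, hut⟩)
    have h' := (hmB t).1 ht
    tauto
  obtain ⟨S1, hS1, hS1u, hS1t⟩ := good_insert hS huB U hU (by
    intro t ht hut
    have htx : t = z := hnuB t ht hut
    subst htx
    exact ⟨e, hUZ, free_spec he, fun y' hy' huy' hne => absurd (hnuB y' hy' huy') hne⟩)
  -- insert `v1`
  have hv1B1 : v1 ∉ insert u B := by simp [hv1B, huv1.ne.symm]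
  have hB1 : insert u B ⊆ A := Finset.insert_subset hu hBA
  obtain ⟨S2, hS2, hS2v, hS2t⟩ := good_insert hS1 hv1B1 T1 hT1 (by
    intro t ht hvt
    rcases (hn1 t).1 (mem_nb.2 ⟨hB1 ht, hvt⟩) with rfl | rfl
    · refine ⟨c1, by rw [hS1u]; exact hT1U, fun s hs hts => ?_, fun s hs hvs hst => ?_⟩
      · have hs' : s = z := by
          refine hnuB s ((Finset.mem_insert.1 hs).resolve_left hts.ne.symm) hts
        subst hs'
        rw [hS1t _ huz.ne.symm]; exact hc1Z
      · have hs' : s = w1 := ((hn1 s).1 (mem_nb.2 ⟨hB1 hs, hvs⟩)).resolve_left hst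
        subst hs'
        rw [hS1t _ hw1u]; exact hc1W
    · refine ⟨a1, by rw [hS1t _ hw1u]; exact hT1W, fun s hs hts => ?_, fun s hs hvs hst => ?_⟩
      · rcases Finset.mem_insert.1 hs with rfl | hs
        · rw [hS1u]; exact ha1U
        · rw [hS1t _ (fun h => huB (h ▸ hs))]; exact free_spec ha1 s hs hts
      · have hs' : s = u := ((hn1 s).1 (mem_nb.2 ⟨hB1 hs, hvs⟩)).resolve_right hst
        subst hs'
        rw [hS1u]; exact ha1U)
  -- insert `v2`
  have hv2B2 : v2 ∉ insert v1 (insert u B) := by simp [hv2B, huv2.ne.symm, hv12.symm]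
  have hB2 : insert v1 (insert u B) ⊆ A := Finset.insert_subset hv1 hB1
  have hS2u : S2 u = U := by rw [hS2t u huv1.ne, hS1u]
  have hS2B : ∀ t ∈ B, S2 t = S t := fun t ht => by
    rw [hS2t t (fun h => hv1B (h ▸ ht)), hS1t t (fun h => huB (h ▸ ht))]
  have hc2T2 : c2 ∈ T2 ∩ U := by rw [hT2U]; exact Finset.mem_singleton_self _
  have hc2T1 : c2 ∉ T1 := fun h => by
    have : c2 ∈ T1 ∩ U := Finset.mem_inter.2 ⟨h, (Finset.mem_inter.1 hc2T2).2⟩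
    rw [hT1U, Finset.mem_singleton] at this
    exact hc12 this.symm
  obtain ⟨S3, hS3, -⟩ := good_insert hS2 hv2B2 T2 hT2 (by
    intro t ht hvt
    rcases (hn2 t).1 (mem_nb.2 ⟨hB2 ht, hvt⟩) with rfl | rfl
    · refine ⟨c2, by rw [hS2u]; exact hT2U, fun s hs hts => ?_, fun s hs hvs hst => ?_⟩
      · rcases Finset.mem_insert.1 hs with rfl | hs
        · rw [hS2v]; exact hc2T1
        · have hsB := (Finset.mem_insert.1 hs).resolve_left hts.ne.symm
          have hs' : s = z := hnuB s hsB hts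
          subst hs'
          rw [hS2B _ hsB]; exact hc2Z
      · have hs' : s = w2 := ((hn2 s).1 (mem_nb.2 ⟨hB2 hs, hvs⟩)).resolve_left hst
        subst hs'
        rw [hS2B _ hw2B]; exact hc2W
    · refine ⟨a2, by rw [hS2B _ hw2B]; exact hT2W, fun s hs hts => ?_, fun s hs hvs hst => ?_⟩
      · rcases Finset.mem_insert.1 hs with rfl | hs
        · rw [hS2v]
          have hw : t = w1 := ((hn1 t).1 (mem_nb.2 ⟨hw2A, hts.symm⟩)).resolve_left hw2u
          intro h
          have h8 : a2 ∈ T1 ∩ S w1 :=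
            Finset.mem_inter.2 ⟨h, hw ▸ free_sub _ _ _ _ _ ha2⟩
          rw [hT1W, Finset.mem_singleton] at h8
          exact hane hw.symm h8.symm
        · rcases Finset.mem_insert.1 hs with rfl | hs
          · rw [hS2u]; exact ha2U
          · rw [hS2B _ hs]; exact free_spec ha2 s hs hts
      · have hs' : s = u := ((hn2 s).1 (mem_nb.2 ⟨hB2 hs, hvs⟩)).resolve_right hst
        subst hs'
        rw [hS2u]; exact ha2U)
  have : insert v2 (insert v1 (insert u B)) = A := by
    ext t; simp only [Finset.mem_insert, hmB]
    constructor
    · rintro (rfl | rfl | rfl | h)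
      exacts [hv2, hv1, hu, h.1]
    · intro h; tauto
  rw [this] at hS3
  exact ⟨S3, hS3⟩

/-! ### Discharging -/

lemma exists_other {V : Type} {s : Finset V} {a : V} (hs : s.card = 2) (ha : a ∈ s) :
    ∃ b, b ≠ a ∧ ∀ t, t ∈ s ↔ t = a ∨ t = b := by
  obtain ⟨x, y, hxy, rfl⟩ := Finset.card_eq_two.1 hs
  rcases Finset.mem_insert.1 ha with rfl | h
  · exact ⟨y, hxy.symm, fun t => by simp⟩
  · rw [Finset.mem_singleton] at h
    subst h
    exact ⟨x, hxy, fun t => by simp [or_comm]⟩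

lemma exists_third {V : Type} {s : Finset V} {a b : V} (hs : s.card = 3) (ha : a ∈ s)
    (hb : b ∈ s) (hab : a ≠ b) :
    ∃ c, c ≠ a ∧ c ≠ b ∧ ∀ t, t ∈ s ↔ t = a ∨ t = b ∨ t = c := by
  have h1 : (s.erase a).card = 2 := by rw [Finset.card_erase_of_mem ha, hs]
  obtain ⟨c, hc, h⟩ := exists_other h1 (Finset.mem_erase.2 ⟨hab.symm, hb⟩)
  have hca : c ∈ s.erase a := (h c).2 (Or.inr rfl)
  refine ⟨c, (Finset.mem_erase.1 hca).1, hc, fun t => ?_⟩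
  rw [← h t, Finset.mem_erase]
  by_cases hta : t = a
  · simp [hta, ha]
  · simp [hta]

/-- A 2-vertex both of whose neighbors have degree at most 7. -/
def Needy {V : Type} (G : SimpleGraph V) (A : Finset V) (v : V) : Prop :=
  (nb G A v).card = 2 ∧ ∀ w ∈ nb G A v, (nb G A w).card ≤ 7

/-- The charge (in thirds) that `v` sends to each neighbor `w`. -/
noncomputable def send {V : Type} (G : SimpleGraph V) (A : Finset V) (v w : V) : ℤ :=
  if 8 ≤ (nb G A v).card then 2 else if Needy G A w then 1 else 0

lemma send_nonneg {V : Type} (G : SimpleGraph V) (A : Finset V) (v w : V) :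
    0 ≤ send G A v w := by
  unfold send; split_ifs <;> simp

lemma discharge {V : Type} {G : SimpleGraph V} {A : Finset V}
    (r1 : ∀ u ∈ A, 2 ≤ (nb G A u).card)
    (r2 : ∀ u ∈ A, ∀ v ∈ A, G.Adj u v → (nb G A u).card = 2 → (nb G A v).card = 2 →
      ∀ x ∈ nb G A u, x ≠ v → 8 ≤ (nb G A x).card)
    (r3 : ∀ u ∈ A, (nb G A u).card = 3 → ∀ v1 v2 z, v1 ≠ v2 → z ≠ v1 → z ≠ v2 →
      (∀ t, t ∈ nb G A u ↔ t = v1 ∨ t = v2 ∨ t = z) → Needy G A v1 → Needy G A v2 →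
      8 ≤ (nb G A z).card) :
    8 * (A.card : ℤ) ≤ 3 * ∑ v ∈ A, ((nb G A v).card : ℤ) := by
  have hpt : ∀ v ∈ A, (8 : ℤ) ≤ 3 * ((nb G A v).card : ℤ) + ∑ w ∈ nb G A v, send G A w v
      - ∑ w ∈ nb G A v, send G A v w := by
    intro v hv
    have hin : 0 ≤ ∑ w ∈ nb G A v, send G A w v :=
      Finset.sum_nonneg (fun w _ => send_nonneg G A w v)
    by_cases h8 : 8 ≤ (nb G A v).card
    · have hout : ∑ w ∈ nb G A v, send G A v w = 2 * ((nb G A v).card : ℤ) := by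
        rw [Finset.sum_congr rfl (fun w _ => show send G A v w = 2 by simp [send, h8])]
        simp [mul_comm]
      rw [hout]
      have : (8 : ℤ) ≤ ((nb G A v).card : ℤ) := by exact_mod_cast h8
      linarith
    · have hsend : ∀ w, send G A v w = if Needy G A w then 1 else 0 := by
        intro w; simp [send, h8]
      have hout : ∑ w ∈ nb G A v, send G A v w = (((nb G A v).filter (Needy G A)).card : ℤ) := by
        rw [Finset.sum_congr rfl (fun w _ => hsend w)]
        simp
      rw [hout]
      have hle : ((nb G A v).filter (Needy G A)).card ≤ (nb G A v).card :=
        Finset.card_filter_le _ _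
      have h2 := r1 v hv
      by_cases h4 : 4 ≤ (nb G A v).card
      · have h4' : (4 : ℤ) ≤ ((nb G A v).card : ℤ) := by exact_mod_cast h4
        have hle' : (((nb G A v).filter (Needy G A)).card : ℤ) ≤ ((nb G A v).card : ℤ) := by
          exact_mod_cast hle
        linarith
      · by_cases h3 : (nb G A v).card = 3
        · by_cases h1 : ((nb G A v).filter (Needy G A)).card ≤ 1
          · have h1' : (((nb G A v).filter (Needy G A)).card : ℤ) ≤ 1 := by exact_mod_cast h1
            rw [h3]; push_cast; linarith
          · obtain ⟨v1, hv1, v2, hv2, hne⟩ := Finset.one_lt_card.1 (not_le.1 h1)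
            rw [Finset.mem_filter] at hv1 hv2
            obtain ⟨z, hz1, hz2, hz⟩ := exists_third h3 hv1.1 hv2.1 hne
            have hz8 := r3 v hv h3 v1 v2 z hne hz1 hz2 hz hv1.2 hv2.2
            have hzn : z ∈ nb G A v := (hz z).2 (by simp)
            have hnz : ¬ Needy G A z := fun h => by
              have := h.1; omega
            have hsz : send G A z v = 2 := by simp [send, hz8]
            have h5 : send G A z v ≤ ∑ w ∈ nb G A v, send G A w v :=
              Finset.single_le_sum (f := fun w => send G A w v)
                (fun w _ => send_nonneg G A w v) hzn
            have hle' : (((nb G A v).filter (Needy G A)).card : ℤ) ≤ 3 := by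
              have hle3 := hle.trans h3.le
              exact_mod_cast hle3
            rw [h3]; push_cast; linarith
        · have h22 : (nb G A v).card = 2 := by omega
          -- no needy neighbors
          have hno : (nb G A v).filter (Needy G A) = ∅ := by
            rw [Finset.filter_eq_empty_iff]
            intro w hw hwn
            obtain ⟨hwA, hvw⟩ := mem_nb.1 hw
            have hvn : v ∈ nb G A w := mem_nb.2 ⟨hv, hvw.symm⟩
            obtain ⟨b, hb, hb'⟩ := exists_other hwn.1 hvn
            have hbn : b ∈ nb G A w := (hb' b).2 (Or.inr rfl)
            have := r2 w hwA v hv hvw.symm hwn.1 h22 b hbn hb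
            have := hwn.2 b hbn
            omega
          rw [hno, h22]
          by_cases hN : Needy G A v
          · have : ∑ w ∈ nb G A v, send G A w v = 2 := by
              rw [Finset.sum_congr rfl (fun w hw => show send G A w v = 1 by
                have := hN.2 w hw
                have h9 : ¬ 8 ≤ (nb G A w).card := by omega
                simp [send, h9, hN])]
              simp [h22]
            rw [this]; simp
          · have : ∃ w ∈ nb G A v, 8 ≤ (nb G A w).card := by
              by_contra hcon
              push Not at hcon
              exact hN ⟨h22, fun w hw => by have := hcon w hw; omega⟩
            obtain ⟨w, hw, hw8⟩ := this
            have hsz : send G A w v = 2 := by simp [send, hw8]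
            have h5 : send G A w v ≤ ∑ w ∈ nb G A v, send G A w v :=
              Finset.single_le_sum (f := fun w => send G A w v)
                (fun w _ => send_nonneg G A w v) hw
            simp
            linarith
  have hsum := Finset.sum_le_sum hpt
  have hswap : ∑ v ∈ A, ∑ w ∈ nb G A v, send G A w v = ∑ v ∈ A, ∑ w ∈ nb G A v, send G A v w := by
    simp only [nb, Finset.sum_filter]
    rw [Finset.sum_comm]
    refine Finset.sum_congr rfl (fun v _ => Finset.sum_congr rfl (fun w _ => ?_))
    simp only [G.adj_comm]
  rw [Finset.sum_sub_distrib, Finset.sum_add_distrib, hswap, ← Finset.mul_sum] at hsum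
  simp at hsum
  linarith

lemma exists_good {V : Type} {G : SimpleGraph V} {D : ℕ} (hD : 9 ≤ D)
    (hmax : ∀ (A : Finset V) v, (nb G A v).card ≤ D)
    (hsp : ∀ A : Finset V, A.Nonempty →
      3 * ∑ v ∈ A, ((nb G A v).card : ℤ) < 8 * (A.card : ℤ)) (A : Finset V) :
    ∃ S, Good G D A S := by
  induction A using Finset.strongInduction with
  | H A ih =>
    by_contra hno
    have hne : A.Nonempty := by
      rw [Finset.nonempty_iff_ne_empty]
      rintro rfl
      exact hno ⟨fun _ => ∅, by simp [Good]⟩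
    refine absurd (hsp A hne) (not_lt.2 (discharge ?_ ?_ ?_))
    · intro u hu
      by_contra hlt
      exact hno (red1 hD (hmax A) ih hu (by omega))
    · intro u hu v hv huv hdu hdv x hx hxv
      by_contra hlt
      obtain ⟨x', hx', hnu⟩ := exists_other hdu (mem_nb.2 ⟨hv, huv⟩)
      obtain ⟨y, hy, hnv⟩ := exists_other hdv (mem_nb.2 ⟨hu, huv.symm⟩)
      have : x = x' := ((hnu x).1 hx).resolve_left hxv
      subst this
      exact hno (red2 hD (hmax A) ih hu hv huv hxv hy hnu hnv (by omega))
    · intro u hu hdu v1 v2 z h12 hz1 hz2 hnu hN1 hN2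
      by_contra hlt
      obtain ⟨hv1, huv1⟩ := mem_nb.1 ((hnu v1).2 (by simp))
      obtain ⟨hv2, huv2⟩ := mem_nb.1 ((hnu v2).2 (by simp))
      have hu1 : u ∈ nb G A v1 := mem_nb.2 ⟨hu, huv1.symm⟩
      have hu2 : u ∈ nb G A v2 := mem_nb.2 ⟨hu, huv2.symm⟩
      obtain ⟨w1, hw1, hn1⟩ := exists_other hN1.1 hu1
      obtain ⟨w2, hw2, hn2⟩ := exists_other hN2.1 hu2
      by_cases hadj : G.Adj v1 v2
      · have e1 : v2 = w1 := ((hn1 v2).1 (mem_nb.2 ⟨hv2, hadj⟩)).resolve_left huv2.ne.symm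
        have e2 : v1 = w2 := ((hn2 v1).1 (mem_nb.2 ⟨hv1, hadj.symm⟩)).resolve_left huv1.ne.symm
        exact hno (red2 hD (hmax A) ih (u := v1) (v := v2) (x := u) (y := u) hv1 hv2 hadj
          huv2.ne huv1.ne (fun t => by rw [hn1, e1, or_comm]) (fun t => by rw [hn2, e2, or_comm])
          (by omega))
      · have hw1n := mem_nb.1 ((hn1 w1).2 (Or.inr rfl))
        have hw2n := mem_nb.1 ((hn2 w2).2 (Or.inr rfl))
        exact hno (red3 hD ih hu h12 hz1 hz2 hw1 hw2
          (fun h => hadj (h ▸ hw1n.2)) (fun h => hadj (h ▸ hw2n.2).symm) hnu hn1 hn2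
          (by omega) (hN1.2 w1 (mem_nb.2 hw1n)) (hN2.2 w2 (mem_nb.2 hw2n)))

/-! ### Back to strong edge-colorings -/

lemma good_to_coloring {V : Type} [Fintype V] {G : SimpleGraph V} {D : ℕ} (hD : 9 ≤ D)
    {S : V → Finset (Fin (3 * D - 3))} (hS : Good G D Finset.univ S) :
    HasStrongColoring G (3 * D - 3) := by
  have hex : ∀ e : Sym2 V, ∃ c : Fin (3 * D - 3), e ∈ G.edgeSet → ∀ v ∈ e, c ∈ S v := by
    intro e
    by_cases he : e ∈ G.edgeSet
    · induction e using Sym2.ind with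
      | _ x y =>
        obtain ⟨c, hc⟩ := hS.2.1 x (Finset.mem_univ _) y (Finset.mem_univ _) he
        have hc' : c ∈ S x ∩ S y := by rw [hc]; exact Finset.mem_singleton_self _
        rw [Finset.mem_inter] at hc'
        refine ⟨c, fun _ v hv => ?_⟩
        rcases Sym2.mem_iff.1 hv with rfl | rfl
        exacts [hc'.1, hc'.2]
    · exact ⟨⟨0, by omega⟩, fun h => absurd h he⟩
  choose C hC using hex
  refine ⟨C, ?_⟩
  have share : ∀ e ∈ G.edgeSet, ∀ e' ∈ G.edgeSet, e ≠ e' → ∀ v, v ∈ e → v ∈ e' → C e ≠ C e' := by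
    intro e he e' he' hne v hv hv' heq
    obtain ⟨a, rfl⟩ := Sym2.mem_iff_exists.1 hv
    obtain ⟨b, rfl⟩ := Sym2.mem_iff_exists.1 hv'
    have hab : a ≠ b := fun h => hne (by rw [h])
    exact hS.2.2 v (Finset.mem_univ _) a (Finset.mem_univ _) b (Finset.mem_univ _) he he' hab
      (C s(v, a)) (hC _ he a (Sym2.mem_mk_right _ _)) (hC _ he v (Sym2.mem_mk_left _ _))
      (heq ▸ hC _ he' b (Sym2.mem_mk_right _ _))
  -- an edge at `v` whose color lies in the palette of a neighbor `w` is `vw`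
  have uniq : ∀ e ∈ G.edgeSet, ∀ v w, v ∈ e → G.Adj v w → C e ∈ S w → e = s(v, w) := by
    intro e he v w hv hvw hCw
    obtain ⟨a, rfl⟩ := Sym2.mem_iff_exists.1 hv
    by_contra hne
    have haw : a ≠ w := fun h => hne (by rw [h])
    exact hS.2.2 v (Finset.mem_univ _) a (Finset.mem_univ _) w (Finset.mem_univ _) he hvw haw
      (C s(v, a)) (hC _ he a (Sym2.mem_mk_right _ _)) (hC _ he v (Sym2.mem_mk_left _ _)) hCw
  rintro e he e' he' ⟨hne, ⟨v, hv, hv'⟩ | ⟨f, hf, ⟨v, hve, hvf⟩, w, hwe, hwf⟩⟩ heq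
  · exact share e he e' he' hne v hv hv' heq
  · by_cases hvw : v = w
    · subst hvw
      exact share e he e' he' hne v hve hwe heq
    · have hfe : f = s(v, w) := (Sym2.mem_and_mem_iff hvw).1 ⟨hvf, hwf⟩
      subst hfe
      have hadj : G.Adj v w := hf
      have h1 := uniq e he v w hve hadj (heq ▸ hC e' he' w hwe)
      have h2 := uniq e' he' w v hwe hadj.symm (heq ▸ hC e he v hve)
      exact hne (by rw [h1, h2, Sym2.eq_swap])

lemma handshake {V : Type} [Fintype V] (G : SimpleGraph V) (A : Finset V) :
    ∑ v ∈ A, (nb G A v).card = 2 * {e ∈ G.edgeSet | ∀ v ∈ e, v ∈ A}.ncard := by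
  let H : SimpleGraph V :=
    { Adj := fun u v => G.Adj u v ∧ u ∈ A ∧ v ∈ A
      symm := ⟨fun u v h => ⟨h.1.symm, h.2.2, h.2.1⟩⟩
      loopless := ⟨fun u h => G.loopless.irrefl u h.1⟩ }
  have h1 : {e ∈ G.edgeSet | ∀ v ∈ e, v ∈ A} = H.edgeSet := by
    ext e
    induction e using Sym2.ind with
    | _ x y => simp [H]
  have h2 := H.sum_degrees_eq_twice_card_edges
  rw [h1, ← SimpleGraph.coe_edgeFinset, Set.ncard_coe_finset, ← h2]
  have h3 : ∀ v, H.degree v = if v ∈ A then (nb G A v).card else 0 := by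
    intro v
    rw [← SimpleGraph.card_neighborFinset_eq_degree]
    split_ifs with hv
    · congr 1
      ext w
      simp [H, mem_nb, hv, and_comm]
    · rw [Finset.card_eq_zero, Finset.eq_empty_iff_forall_notMem]
      intro w
      simp [H, hv]
  rw [Finset.sum_congr rfl (fun v _ => h3 v)]
  simp

lemma sparse_of_mad {V : Type} [Fintype V] (G : SimpleGraph V) (h : mad G < 8 / 3)
    (A : Finset V) (hA : A.Nonempty) :
    3 * ∑ v ∈ A, ((nb G A v).card : ℤ) < 8 * (A.card : ℤ) := by
  have hfin : {x : ℝ | ∃ A : Finset V, A.Nonempty ∧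
      x = 2 * ({e ∈ G.edgeSet | ∀ v ∈ e, v ∈ A}.ncard : ℝ) / (A.card : ℝ)}.Finite := by
    refine (Set.finite_range (fun A : Finset V =>
      2 * ({e ∈ G.edgeSet | ∀ v ∈ e, v ∈ A}.ncard : ℝ) / (A.card : ℝ))).subset ?_
    rintro x ⟨A, -, rfl⟩
    exact ⟨A, rfl⟩
  have h1 : 2 * ({e ∈ G.edgeSet | ∀ v ∈ e, v ∈ A}.ncard : ℝ) / (A.card : ℝ) ≤ mad G :=
    le_csSup hfin.bddAbove ⟨A, hA, rfl⟩
  have h2 := h1.trans_lt h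
  have hpos : (0 : ℝ) < A.card := by exact_mod_cast hA.card_pos
  rw [div_lt_div_iff₀ hpos (by norm_num)] at h2
  have h3 : 2 * {e ∈ G.edgeSet | ∀ v ∈ e, v ∈ A}.ncard * 3 < 8 * A.card := by exact_mod_cast h2
  have h4 := handshake G A
  rw [← h4] at h3
  have h5 : ((∑ v ∈ A, (nb G A v).card : ℕ) : ℤ) * 3 < 8 * (A.card : ℤ) := by exact_mod_cast h3
  push_cast at h5
  linarith

/-- Graphs with maximum average degree less than `8/3` and maximum degree at most `D`, where
`D ≥ 9`, have a strong `(3D - 3)`-edge-coloring. -/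
theorem goodA_hasStrongColoring {D : ℕ} (hD : 9 ≤ D) {V : Type} [Fintype V]
    (G : SimpleGraph V) (hG : GoodA D G) : HasStrongColoring G (3 * D - 3) := by
  obtain ⟨S, hS⟩ := exists_good (G := G) hD (fun A v => by
    refine le_trans ?_ ((G.degree_le_maxDegree v).trans hG.2)
    rw [← SimpleGraph.card_neighborFinset_eq_degree]
    apply Finset.card_le_card
    intro w hw
    simpa using (mem_nb.1 hw).2) (sparse_of_mad G hG.1) Finset.univ
  exact good_to_coloring hD hS

/-- In a minimal counterexample `G` to `χ'_s ≤ 3Δ - 3` for graphs with `Mad < 8/3` and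
maximum degree at most `Δ ≥ 9`, every vertex of `G*` has degree at least 2 in `G*`. -/
theorem minCexA_core_min_degree_two (Δ : ℕ) (hΔ : 9 ≤ Δ) {V : Type} [Fintype V]
    (G : SimpleGraph V) (hG : MinCexA Δ G) :
    ∀ v : V, G.degree v ≠ 1 → 2 ≤ (core G).degree v := by
  -- The full bound holds, so there are no minimal counterexamples at all.
  exact absurd (goodA_hasStrongColoring hΔ G hG.1) hG.2.1

end StrongEC
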